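/- Let P = (X, d, x̄) be any presentation of a Polish space X. Then for every countable closed subset F ⊆ X one has |F|_CB ≤ φ_P(F). -/

import Mathlib

open Set Filter Topology

/-- A presentation `(X, d, x̄)` of a Polish space `X`: a complete metric `d`
compatible with the topology of `X`, together with a dense sequence `x̄`. -/
structure Presentation (X : Type) [TopologicalSpace X] where
  dist : X → X → ℝ
  seq : ℕ → X
  dist_self : ∀ x, dist x x = 0
  eq_of_dist_eq_zero : ∀ x y, dist x y = 0 → x = y
  dist_comm : ∀ x y, dist x y = dist y x
  dist_triangle : ∀ x y z, dist x z ≤ dist x y + dist y z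
  /-- `d` is compatible with the topology of `X`. -/
  isOpen_iff : ∀ s : Set X, IsOpen s ↔ ∀ x ∈ s, ∃ ε > 0, ∀ y, dist y x < ε → y ∈ s
  /-- `d` is complete. -/
  complete : ∀ u : ℕ → X, (∀ ε > 0, ∃ N, ∀ m ≥ N, ∀ n ≥ N, dist (u m) (u n) < ε) →
      ∃ x, ∀ ε > 0, ∃ N, ∀ n ≥ N, dist (u n) x < ε
  /-- the sequence `x̄` is dense. -/
  dense : ∀ x, ∀ ε > 0, ∃ i, dist x (seq i) < ε

namespace Presentation

variable {X : Type} [TopologicalSpace X] (P : Presentation X)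

/-- The open ball `B_P(n)`. -/
def ball (n : ℕ × ℕ) : Set X := {x | P.dist x (P.seq n.1) < (1/2 : ℝ) ^ (n.2 + 1)}

/-- The closed ball `B̄_P(n)`. -/
def cball (n : ℕ × ℕ) : Set X := {x | P.dist x (P.seq n.1) ≤ (1/2 : ℝ) ^ (n.2 + 1)}

/-- The relation `n ≺_P m`. -/
def prec (n m : ℕ × ℕ) : Prop := n.2 < m.2 ∧ P.cball m ⊆ P.ball n

/-- The relation `n ⋏_P m`. -/
def apart (n m : ℕ × ℕ) : Prop := P.cball n ∩ P.cball m = ∅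

/-- The code `A_F^P` of a closed set `F ⊆ X`. -/
def code (F : Set X) : Set (ℕ × ℕ) := {n | (P.ball n ∩ F).Nonempty}

/-- The derivative `D_P` on subsets of `ω × ω`. -/
def deriv (A : Set (ℕ × ℕ)) : Set (ℕ × ℕ) :=
  {n ∈ A | ∃ u ∈ A, ∃ v ∈ A, P.prec n u ∧ P.prec n v ∧ P.apart u v}

/-- The transfinite iterates `D_P^α(A)`. -/
noncomputable def derivIter (A : Set (ℕ × ℕ)) (α : Ordinal.{0}) : Set (ℕ × ℕ) :=
  Ordinal.limitRecOn α A (fun _ ih => P.deriv ih)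
    (fun o _ ih => ⋂ (β : {β : Ordinal.{0} // β < o}), ih β.1 β.2)

/-- The rank `|A|_P`: the least ordinal `α` with `D_P^α(A) = D_P^{α+1}(A)`. -/
noncomputable def rankA (A : Set (ℕ × ℕ)) : Ordinal.{0} :=
  sInf {α | P.derivIter A (α + 1) = P.derivIter A α}

/-- The rank `φ_P(F) = |A_F^P|_P` of a (countable closed) subset `F ⊆ X`. -/
noncomputable def phi (F : Set X) : Ordinal.{0} := P.rankA (P.code F)

/-- `A ⊆ ω × ω` is `P`-closed. -/
def PClosed (A : Set (ℕ × ℕ)) : Prop := ∀ n ∈ A, ∀ m, P.prec m n → m ∈ A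

/-- `A ⊆ ω × ω` is `P`-pruned. -/
def PPruned (A : Set (ℕ × ℕ)) : Prop := ∀ n ∈ A, ∃ m ∈ A, P.prec n m

/-- `A ⊆ ω × ω` is `P`-perfect. -/
def PPerfect (A : Set (ℕ × ℕ)) : Prop :=
  ∀ n ∈ A, ∃ u ∈ A, ∃ v ∈ A, P.prec n u ∧ P.prec n v ∧ P.apart u v

/-- The set `[A]_P` of `P`-compatible sequences lying in `A`. -/
def body (A : Set (ℕ × ℕ)) : Set (ℕ → ℕ × ℕ) :=
  {f | (∀ i, P.prec (f i) (f (i + 1))) ∧ ∀ i, f i ∈ A}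

/-- The set `F_A^P = π_P([A]_P)`: the points obtained as the unique point of
`⋂_i B_P(n_i)` for a `P`-compatible sequence `(n_i)` in `A`. -/
def limitSet (A : Set (ℕ × ℕ)) : Set X :=
  {x | ∃ f ∈ P.body A, ∀ i, x ∈ P.ball (f i)}

end Presentation

section CB

variable {X : Type} [TopologicalSpace X]

/-- The Cantor–Bendixson derivative: the set of limit points of `F` in `F`. -/
def cbDeriv (F : Set X) : Set X := {x ∈ F | AccPt x (𝓟 F)}

/-- The iterated Cantor–Bendixson derivatives `F^α`. -/
noncomputable def cbIter (F : Set X) (α : Ordinal.{0}) : Set X :=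
  Ordinal.limitRecOn α F (fun _ ih => cbDeriv ih)
    (fun o _ ih => ⋂ (β : {β : Ordinal.{0} // β < o}), ih β.1 β.2)

/-- The Cantor–Bendixson rank `|F|_CB`. -/
noncomputable def cbRank (F : Set X) : Ordinal.{0} :=
  sInf {α | cbIter F (α + 1) = cbIter F α}

/-- The `K_σ`-derivative of a subset `A ⊆ X`: the points of `A` having no open
neighborhood in the subspace `A` whose closure in `A` is compact. -/
def kDeriv (A : Set X) : Set X :=
  {x ∈ A | ∀ U : Set X, IsOpen U → x ∈ U → ¬ IsCompact (A ∩ closure (U ∩ A))}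

/-- The iterated `K_σ`-derivatives `X_α` of the space `X`. -/
noncomputable def kIter (X : Type) [TopologicalSpace X] (α : Ordinal.{0}) : Set X :=
  Ordinal.limitRecOn α Set.univ (fun _ ih => kDeriv ih)
    (fun o _ ih => ⋂ (β : {β : Ordinal.{0} // β < o}), ih β.1 β.2)

/-- The `K_σ`-rank `|X|_{K_σ}`. -/
noncomputable def kRank (X : Type) [TopologicalSpace X] : Ordinal.{0} :=
  sInf {α | kIter X (α + 1) = kIter X α}

end CB

namespace Presentation

variable {X : Type} [TopologicalSpace X] (P : Presentation X)

theorem derivIter_zero (A : Set (ℕ × ℕ)) : P.derivIter A 0 = A :=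
  Ordinal.limitRecOn_zero ..

theorem derivIter_add_one (A : Set (ℕ × ℕ)) (α : Ordinal.{0}) :
    P.derivIter A (α + 1) = P.deriv (P.derivIter A α) :=
  Ordinal.limitRecOn_add_one ..

theorem derivIter_limit (A : Set (ℕ × ℕ)) {α : Ordinal.{0}} (hα : Order.IsSuccLimit α) :
    P.derivIter A α = ⋂ β : {β : Ordinal.{0} // β < α}, P.derivIter A β.1 :=
  Ordinal.limitRecOn_limit _ _ _ _ hα

theorem deriv_subset (A : Set (ℕ × ℕ)) : P.deriv A ⊆ A := fun _ h => h.1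

theorem deriv_mono {A B : Set (ℕ × ℕ)} (h : A ⊆ B) : P.deriv A ⊆ P.deriv B := by
  rintro n ⟨hn, u, hu, v, hv, huv⟩
  exact ⟨h hn, u, h hu, v, h hv, huv⟩

theorem derivIter_antitone (A : Set (ℕ × ℕ)) : Antitone (P.derivIter A) := by
  intro α β h
  induction β using Ordinal.limitRecOn with
  | zero => rw [le_antisymm h zero_le]
  | add_one β ih =>
    rcases h.eq_or_lt with rfl | h
    · rfl
    · rw [derivIter_add_one]
      exact (P.deriv_subset _).trans (ih (Order.lt_add_one_iff.1 h))
  | limit β hβ _ =>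
    rcases h.eq_or_lt with rfl | h
    · rfl
    · rw [P.derivIter_limit A hβ]
      exact iInter_subset (fun β' : {γ : Ordinal.{0} // γ < β} => P.derivIter A β'.1) ⟨α, h⟩

/-- The iterated derivative is stationary at the rank. -/
theorem derivIter_rankA (A : Set (ℕ × ℕ)) :
    P.derivIter A (P.rankA A + 1) = P.derivIter A (P.rankA A) := by
  suffices h : {α | P.derivIter A (α + 1) = P.derivIter A α}.Nonempty from csInf_mem h
  by_contra hne
  have hlt : ∀ α β, α < β → P.derivIter A α ≠ P.derivIter A β := by
    intro α β h e
    refine hne ⟨α, (P.derivIter_antitone A le_self_add).antisymm ?_⟩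
    rw [e]
    exact P.derivIter_antitone A (Order.add_one_le_of_lt h)
  refine not_injective_of_ordinal (P.derivIter A) fun α β e => ?_
  rcases lt_trichotomy α β with h | h | h
  · exact (hlt _ _ h e).elim
  · exact h
  · exact (hlt _ _ h e.symm).elim

theorem dist_nonneg (x y : X) : 0 ≤ P.dist x y := by
  have h := P.dist_triangle x y x
  rw [P.dist_self, P.dist_comm y x] at h
  linarith

theorem isOpen_ball (n : ℕ × ℕ) : IsOpen (P.ball n) := by
  refine (P.isOpen_iff _).2 fun x hx => ⟨(1/2 : ℝ) ^ (n.2 + 1) - P.dist x (P.seq n.1),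
    sub_pos.2 hx, fun y hy => ?_⟩
  have := P.dist_triangle y x (P.seq n.1)
  change P.dist y (P.seq n.1) < _
  linarith

theorem ball_subset_cball (n : ℕ × ℕ) : P.ball n ⊆ P.cball n :=
  fun x (hx : P.dist x _ < _) => show P.dist x _ ≤ _ from hx.le

/-- Every point lies in basic balls whose closed versions are arbitrarily small. -/
theorem exists_mem_ball_small (z : X) (N : ℕ) {δ : ℝ} (hδ : 0 < δ) :
    ∃ u : ℕ × ℕ, N < u.2 ∧ z ∈ P.ball u ∧ ∀ w ∈ P.cball u, P.dist w z < δ := by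
  obtain ⟨k, hk⟩ := exists_pow_lt_of_lt_one hδ (by norm_num : (1/2 : ℝ) < 1)
  obtain ⟨i, hi⟩ := P.dense z ((1/2 : ℝ) ^ (k + N + 1 + 1)) (by positivity)
  refine ⟨(i, k + N + 1), by simp only; omega, hi, fun w hw => ?_⟩
  change P.dist w (P.seq i) ≤ (1/2 : ℝ) ^ (k + N + 1 + 1) at hw
  have h1 := P.dist_triangle w (P.seq i) z
  rw [P.dist_comm (P.seq i) z] at h1
  have h2 : (1/2 : ℝ) ^ (k + N + 1) ≤ (1/2 : ℝ) ^ k :=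
    pow_le_pow_of_le_one (by norm_num) (by norm_num) (by omega)
  rw [pow_succ _ (k + N + 1)] at hw hi
  linarith

theorem exists_prec_mem_ball_small {n : ℕ × ℕ} {z : X} (hz : z ∈ P.ball n) {δ : ℝ} (hδ : 0 < δ) :
    ∃ u : ℕ × ℕ, P.prec n u ∧ z ∈ P.ball u ∧ ∀ w ∈ P.cball u, P.dist w z < δ := by
  obtain ⟨ε, hε, hball⟩ := (P.isOpen_iff _).1 (P.isOpen_ball n) z hz
  obtain ⟨u, hu, hzu, hw⟩ := P.exists_mem_ball_small z n.2 (lt_min hε hδ)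
  exact ⟨u, ⟨hu, fun w h => hball w ((hw w h).trans_le (min_le_left _ _))⟩, hzu,
    fun w h => (hw w h).trans_le (min_le_right _ _)⟩

theorem code_cbDeriv_subset (F : Set X) : P.code (cbDeriv F) ⊆ P.deriv (P.code F) := by
  rintro n ⟨x, hxn, hxF, hx⟩
  obtain ⟨y, ⟨hyn, hyF⟩, hyx⟩ := accPt_iff_nhds.1 hx _ ((P.isOpen_ball n).mem_nhds hxn)
  have hd : 0 < P.dist x y := (P.dist_nonneg x y).lt_of_ne' fun h =>
    hyx (P.eq_of_dist_eq_zero x y h).symm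
  obtain ⟨u, hnu, hxu, hu⟩ := P.exists_prec_mem_ball_small hxn (half_pos hd)
  obtain ⟨v, hnv, hyv, hv⟩ := P.exists_prec_mem_ball_small hyn (half_pos hd)
  refine ⟨⟨x, hxn, hxF⟩, u, ⟨x, hxu, hxF⟩, v, ⟨y, hyv, hyF⟩, hnu, hnv, ?_⟩
  refine eq_empty_of_forall_notMem fun w hw => ?_
  have h1 := hu w hw.1
  have h2 := hv w hw.2
  have h3 := P.dist_triangle x w y
  rw [P.dist_comm x w] at h3
  linarith

theorem eq_empty_of_code_eq_empty {F : Set X} (h : P.code F = ∅) : F = ∅ := by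
  refine eq_empty_of_forall_notMem fun x hx => ?_
  obtain ⟨u, -, hxu, -⟩ := P.exists_mem_ball_small x 0 one_pos
  exact (h ▸ (⟨x, hxu, hx⟩ : u ∈ P.code F) : u ∈ (∅ : Set (ℕ × ℕ)))

/-- Along a chain of balls meeting a closed set `F`, some point of `F` lies in every closed ball. -/
theorem exists_mem_iInter_cball {F : Set X} (hF : IsClosed F) {f : ℕ → ℕ × ℕ}
    (hf : ∀ i, P.prec (f i) (f (i + 1))) (hfF : ∀ i, f i ∈ P.code F) :
    ∃ x ∈ F, ∀ i, x ∈ P.cball (f i) := by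
  choose y hy hyF using hfF
  have hanti : Antitone fun i => P.cball (f i) :=
    antitone_nat_of_succ_le fun i => (hf i).2.trans (P.ball_subset_cball _)
  have hmem : ∀ i m, i ≤ m → P.dist (y m) (P.seq (f i).1) ≤ (1/2 : ℝ) ^ ((f i).2 + 1) :=
    fun i m h => hanti h (P.ball_subset_cball _ (hy m))
  have hrad : ∀ i, (1/2 : ℝ) ^ ((f i).2 + 1) ≤ (1/2 : ℝ) ^ (i + 1) := fun i =>
    pow_le_pow_of_le_one (by norm_num) (by norm_num)
      (Nat.succ_le_succ ((strictMono_nat_of_lt_succ fun i => (hf i).1).le_apply))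
  obtain ⟨x, hx⟩ := P.complete y fun ε hε => by
    obtain ⟨N, hN⟩ := exists_pow_lt_of_lt_one hε (by norm_num : (1/2 : ℝ) < 1)
    refine ⟨N, fun m hm k hk => ?_⟩
    have h1 := P.dist_triangle (y m) (P.seq (f N).1) (y k)
    rw [P.dist_comm (P.seq (f N).1)] at h1
    have h2 := hmem N m hm
    have h3 := hmem N k hk
    have h4 := hrad N
    rw [pow_succ _ N] at h4
    linarith
  refine ⟨x, ?_, fun i => show P.dist x _ ≤ _ from le_of_forall_pos_le_add fun ε hε => ?_⟩
  · by_contra hxF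
    obtain ⟨ε, hε, hball⟩ := (P.isOpen_iff _).1 hF.isOpen_compl x hxF
    obtain ⟨N, hN⟩ := hx ε hε
    exact hball _ (hN N le_rfl) (hyF N)
  · obtain ⟨N, hN⟩ := hx ε hε
    have h1 := hN (max N i) (le_max_left _ _)
    have h2 := hmem i (max N i) (le_max_right _ _)
    have h3 := P.dist_triangle x (y (max N i)) (P.seq (f i).1)
    rw [P.dist_comm x (y (max N i))] at h3
    linarith

/-- A `P`-perfect set of balls meeting a countable closed set is empty. -/
theorem PPerfect.eq_empty {P : Presentation X} {A : Set (ℕ × ℕ)} (hA : P.PPerfect A) {F : Set X}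
    (hF : IsClosed F) (hcnt : F.Countable) (hAF : A ⊆ P.code F) : A = ∅ := by
  by_contra hne
  obtain ⟨a, ha⟩ := nonempty_iff_ne_empty.2 hne
  obtain ⟨x₀, -, hx₀⟩ := hAF ha
  obtain ⟨g, hg⟩ := hcnt.exists_eq_range ⟨x₀, hx₀⟩
  have hstep : ∀ (i : ℕ) (n : A), ∃ m : A, P.prec n m ∧ g i ∉ P.cball m := by
    rintro i ⟨n, hn⟩
    obtain ⟨u, hu, v, hv, hnu, hnv, huv⟩ := hA n hn
    by_cases h : g i ∈ P.cball u
    · exact ⟨⟨v, hv⟩, hnv, fun h' => eq_empty_iff_forall_notMem.1 huv _ ⟨h, h'⟩⟩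
    · exact ⟨⟨u, hu⟩, hnu, h⟩
  choose next hprec hnot using hstep
  obtain ⟨f, hf⟩ : ∃ f : ℕ → A, ∀ i, f (i + 1) = next i (f i) :=
    ⟨fun i => Nat.rec ⟨a, ha⟩ next i, fun _ => rfl⟩
  obtain ⟨x, hxF, hx⟩ := P.exists_mem_iInter_cball hF (f := fun i => (f i).1)
    (fun i => by simpa only [hf] using hprec i (f i)) fun i => hAF (f i).2
  obtain ⟨i, rfl⟩ := hg ▸ hxF
  exact hnot i (f i) (hf i ▸ hx (i + 1))

end Presentation

section CB

variable {X : Type} [TopologicalSpace X]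

theorem cbIter_zero (F : Set X) : cbIter F 0 = F :=
  Ordinal.limitRecOn_zero ..

theorem cbIter_add_one (F : Set X) (α : Ordinal.{0}) :
    cbIter F (α + 1) = cbDeriv (cbIter F α) :=
  Ordinal.limitRecOn_add_one ..

theorem cbIter_limit (F : Set X) {α : Ordinal.{0}} (hα : Order.IsSuccLimit α) :
    cbIter F α = ⋂ β : {β : Ordinal.{0} // β < α}, cbIter F β.1 :=
  Ordinal.limitRecOn_limit _ _ _ _ hα

theorem Presentation.code_cbIter_subset (P : Presentation X) (F : Set X) (α : Ordinal.{0}) :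
    P.code (cbIter F α) ⊆ P.derivIter (P.code F) α := by
  induction α using Ordinal.limitRecOn with
  | zero => rw [cbIter_zero, derivIter_zero]
  | add_one α ih =>
    rw [cbIter_add_one, derivIter_add_one]
    exact (P.code_cbDeriv_subset _).trans (P.deriv_mono ih)
  | limit α hα ih =>
    rw [cbIter_limit F hα, P.derivIter_limit _ hα]
    rintro n ⟨x, hxn, hx⟩
    exact mem_iInter.2 fun β => ih β.1 β.2 ⟨x, hxn, mem_iInter.1 hx β⟩

end CB

/-- For any presentation `P` of a Polish space `X` and any countable closed
`F ⊆ X`, `|F|_CB ≤ φ_P(F)`. -/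
theorem stmt3 {X : Type} [TopologicalSpace X] [PolishSpace X] (P : Presentation X)
    (F : Set X) (hF : IsClosed F) (hcnt : F.Countable) :
    cbRank F ≤ P.phi F := by
  have hstat := P.derivIter_rankA (P.code F)
  rw [P.derivIter_add_one] at hstat
  have hperf : P.PPerfect (P.derivIter (P.code F) (P.phi F)) := fun n hn =>
    (hstat.symm ▸ hn : n ∈ P.deriv (P.derivIter (P.code F) (P.rankA (P.code F)))).2
  have hsub : P.derivIter (P.code F) (P.phi F) ⊆ P.code F :=
    (P.derivIter_antitone _ zero_le).trans_eq (P.derivIter_zero _)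
  have hempty : cbIter F (P.phi F) = ∅ := P.eq_empty_of_code_eq_empty <|
    subset_empty_iff.1 <|
      (P.code_cbIter_subset F _).trans_eq (hperf.eq_empty hF hcnt hsub)
  refine csInf_le' ?_
  rw [mem_ofPred_eq, cbIter_add_one, hempty]
  exact subset_empty_iff.1 fun x hx => hx.1
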